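/- Let d ≥ k ≥ 1 be integers, β ∈ (0,1) and δ ≥ 0 real numbers, and q ∈ ℤ^k a lattice point. For ρ ≥ 0 let N(ρ) be the number of lattice points z ∈ ℤ^k with ‖z − q‖ ≤ ρ. If r'' > 2·d^{3/2}/β and r'' ≤ r' ≤ (1 + δ)·r'', then N(r'') ≤ N(r') ≤ ((1+β)/(1−β))·(1+δ)^k·N(r''). -/

import Mathlib

open MeasureTheory
open scoped Pointwise

/-- The closed Euclidean ball of radius `ρ` about the origin, as a subset of `Fin k → ℝ`. -/
def euclideanBall (k : ℕ) (ρ : ℝ) : Set (Fin k → ℝ) := {x | ‖WithLp.toLp 2 x‖ ≤ ρ}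

/-- The lattice points of norm at most `ρ`. -/
def latticeBall (k : ℕ) (ρ : ℝ) : Set (Fin k → ℤ) := {z | ∑ i, (z i : ℝ) ^ 2 ≤ ρ ^ 2}

/-- The half-open unit cube centered at the lattice point `z`. -/
def latticeCube {k : ℕ} (z : Fin k → ℤ) : Set (Fin k → ℝ) :=
  Set.univ.pi fun i => Set.Ico ((z i : ℝ) - 1 / 2) ((z i : ℝ) + 1 / 2)

lemma volume_latticeCube {k : ℕ} (z : Fin k → ℤ) : volume (latticeCube z) = 1 := by
  rw [latticeCube, volume_pi_pi]
  simp only [Real.volume_Ico]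
  refine Finset.prod_eq_one fun i _ => ?_
  ring_nf
  simp

lemma measurableSet_latticeCube {k : ℕ} (z : Fin k → ℤ) : MeasurableSet (latticeCube z) :=
  MeasurableSet.univ_pi fun _ => measurableSet_Ico

lemma disjoint_latticeCube {k : ℕ} {z w : Fin k → ℤ} (h : z ≠ w) :
    Disjoint (latticeCube z) (latticeCube w) := by
  rw [Set.disjoint_left]
  intro x hz hw
  refine h (funext fun i => ?_)
  have h1 := hz i (Set.mem_univ i)
  have h2 := hw i (Set.mem_univ i)
  simp only [Set.mem_Ico] at h1 h2
  have h3 : (z i : ℝ) < w i + 1 := by linarith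
  have h4 : (w i : ℝ) < z i + 1 := by linarith
  norm_cast at h3 h4
  omega

lemma exists_mem_latticeCube {k : ℕ} (x : Fin k → ℝ) : ∃ z, x ∈ latticeCube z := by
  refine ⟨fun i => ⌊x i + 1 / 2⌋, fun i _ => ?_⟩
  have h1 := Int.floor_le (x i + 1 / 2)
  have h2 := Int.lt_floor_add_one (x i + 1 / 2)
  constructor <;> linarith

lemma norm_sub_le_of_mem_latticeCube {k : ℕ} {x : Fin k → ℝ} {z : Fin k → ℤ}
    (h : x ∈ latticeCube z) :
    ‖WithLp.toLp 2 x - WithLp.toLp 2 (fun i => (z i : ℝ))‖ ≤ √k / 2 := by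
  rw [EuclideanSpace.norm_eq]
  refine Real.sqrt_le_iff.2 ⟨by positivity, ?_⟩
  rw [div_pow, Real.sq_sqrt (Nat.cast_nonneg k)]
  calc _ ≤ ∑ _i : Fin k, (1 / 4 : ℝ) := by
        refine Finset.sum_le_sum fun i _ => ?_
        have hi := h i (Set.mem_univ i)
        simp only [Set.mem_Ico] at hi
        simp only [PiLp.sub_apply, Real.norm_eq_abs, sq_abs]
        nlinarith
    _ = _ := by simp; ring

lemma mem_latticeBall_iff {k : ℕ} {ρ : ℝ} (hρ : 0 ≤ ρ) (z : Fin k → ℤ) :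
    z ∈ latticeBall k ρ ↔ ‖WithLp.toLp 2 (fun i => (z i : ℝ))‖ ≤ ρ := by
  rw [EuclideanSpace.norm_eq, Real.sqrt_le_left hρ]
  simp [latticeBall]

lemma finite_latticeBall (k : ℕ) (ρ : ℝ) : (latticeBall k ρ).Finite := by
  refine (Set.finite_Icc (fun _ : Fin k => -⌈|ρ|⌉) (fun _ => ⌈|ρ|⌉)).subset fun z hz => ?_
  have key : ∀ i, |(z i : ℝ)| ≤ ⌈|ρ|⌉ := fun i =>
    (sq_le_sq.1 ((Finset.single_le_sum (f := fun i => (z i : ℝ) ^ 2)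
      (fun j _ => sq_nonneg _) (Finset.mem_univ i)).trans hz)).trans (Int.le_ceil _)
  constructor <;> intro i <;> have := abs_le.1 (key i)
  · exact_mod_cast this.1
  · exact_mod_cast this.2

lemma volume_euclideanBall (k : ℕ) {ρ : ℝ} (hρ : 0 < ρ) :
    volume (euclideanBall k ρ) = ENNReal.ofReal (ρ ^ k) * volume (euclideanBall k 1) := by
  have h : euclideanBall k ρ = ρ • euclideanBall k 1 := by
    ext x
    rw [Set.mem_smul_set_iff_inv_smul_mem₀ hρ.ne']
    simp only [euclideanBall, Set.mem_ofPred_eq, WithLp.toLp_smul, norm_smul, norm_inv,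
      Real.norm_eq_abs, abs_of_pos hρ]
    rw [inv_mul_le_iff₀ hρ, mul_one]
  rw [h, Measure.addHaar_smul, Module.finrank_fin_fun, abs_of_pos (by positivity)]

lemma ncard_latticeBall_le_volume (k : ℕ) {ρ : ℝ} (hρ : 0 ≤ ρ) :
    ((latticeBall k ρ).ncard : ENNReal) ≤ volume (euclideanBall k (ρ + √k / 2)) := by
  have hfin := finite_latticeBall k ρ
  have hvol : volume (⋃ z ∈ hfin.toFinset, latticeCube z) = (latticeBall k ρ).ncard := by
    rw [measure_biUnion_finset (fun z _ w _ h => disjoint_latticeCube h)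
      (fun z _ => measurableSet_latticeCube z), Set.ncard_eq_toFinset_card _ hfin]
    simp [volume_latticeCube]
  rw [← hvol]
  refine measure_mono (Set.iUnion₂_subset fun z hz x hx => ?_)
  have hz' := (mem_latticeBall_iff hρ z).1 (hfin.mem_toFinset.1 hz)
  have := norm_sub_le_of_mem_latticeCube hx
  have := norm_sub_norm_le (WithLp.toLp 2 x) (WithLp.toLp 2 (fun i => (z i : ℝ)))
  simp only [euclideanBall, Set.mem_ofPred_eq]
  linarith

lemma volume_le_ncard_latticeBall (k : ℕ) {ρ : ℝ} (hρ : 0 ≤ ρ) :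
    volume (euclideanBall k (ρ - √k / 2)) ≤ ((latticeBall k ρ).ncard : ENNReal) := by
  have hfin := finite_latticeBall k ρ
  calc volume (euclideanBall k (ρ - √k / 2))
      ≤ volume (⋃ z ∈ hfin.toFinset, latticeCube z) := by
        refine measure_mono fun x hx => ?_
        obtain ⟨z, hz⟩ := exists_mem_latticeCube x
        refine Set.mem_iUnion₂.2 ⟨z, hfin.mem_toFinset.2 ((mem_latticeBall_iff hρ z).2 ?_), hz⟩
        have h1 := norm_sub_le_of_mem_latticeCube hz
        have h2 := norm_sub_norm_le (WithLp.toLp 2 (fun i => (z i : ℝ))) (WithLp.toLp 2 x)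
        rw [norm_sub_rev] at h2
        simp only [euclideanBall, Set.mem_ofPred_eq] at hx
        linarith
    _ ≤ ∑ z ∈ hfin.toFinset, volume (latticeCube z) := measure_biUnion_finset_le _ _
    _ = _ := by
        rw [Set.ncard_eq_toFinset_card _ hfin]
        simp [volume_latticeCube]

/-- Comparison of the lattice point counts of two balls through the volumes of the ball of radius
`R + √k / 2` and the ball of radius `r - √k / 2`. -/
lemma ncard_latticeBall_mul_pow_le (k : ℕ) {r R : ℝ} (hr : √k / 2 < r) (hR : 0 < R) :
    ((latticeBall k R).ncard : ℝ) * (r - √k / 2) ^ k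
      ≤ (R + √k / 2) ^ k * (latticeBall k r).ncard := by
  have hs : 0 ≤ √(k : ℝ) / 2 := by positivity
  have hr' : 0 < r - √k / 2 := sub_pos.2 hr
  have h1 := ncard_latticeBall_le_volume k hR.le
  have h2 := volume_le_ncard_latticeBall k (hs.trans hr.le)
  rw [volume_euclideanBall k (by positivity)] at h1
  rw [volume_euclideanBall k hr'] at h2
  have h3 : ((latticeBall k R).ncard : ENNReal) * ENNReal.ofReal ((r - √k / 2) ^ k)
      ≤ ENNReal.ofReal ((R + √k / 2) ^ k) * (latticeBall k r).ncard :=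
    calc _ ≤ ENNReal.ofReal ((R + √k / 2) ^ k) * volume (euclideanBall k 1)
            * ENNReal.ofReal ((r - √k / 2) ^ k) := by gcongr
      _ = ENNReal.ofReal ((R + √k / 2) ^ k)
            * (ENNReal.ofReal ((r - √k / 2) ^ k) * volume (euclideanBall k 1)) := by ring
      _ ≤ _ := by gcongr
  have h4 := ENNReal.toReal_mono (by finiteness) h3
  rwa [ENNReal.toReal_mul, ENNReal.toReal_mul, ENNReal.toReal_natCast, ENNReal.toReal_natCast,
    ENNReal.toReal_ofReal (by positivity), ENNReal.toReal_ofReal (by positivity)] at h4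

lemma ncard_translate_latticeBall {k : ℕ} (q : Fin k → ℤ) (ρ : ℝ) :
    {z : Fin k → ℤ | ∑ i : Fin k, ((z i : ℝ) - (q i : ℝ)) ^ 2 ≤ ρ ^ 2}.ncard
      = (latticeBall k ρ).ncard := by
  rw [← Set.ncard_image_of_injective (latticeBall k ρ) (add_left_injective q)]
  congr 1
  ext z
  simp only [Set.mem_ofPred_eq, Set.mem_image, latticeBall]
  constructor
  · intro h
    exact ⟨z - q, by simpa using h, by simp⟩
  · rintro ⟨w, hw, rfl⟩
    simpa using hw

lemma one_add_pow_mul_le {k : ℕ} {x β : ℝ} (hx : 0 ≤ x) (hx1 : x < 1) (hβ0 : 0 < β) (hβ1 : β < 1)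
    (hkx : k * x ≤ β / 4) : (1 + x) ^ k * (1 - β) ≤ (1 + β) * (1 - x) ^ k := by
  have hbern : 1 - β / 4 ≤ (1 - x) ^ k := by
    have := one_add_mul_le_pow (a := -x) (by linarith) k
    rw [← sub_eq_add_neg] at this
    linarith
  have hprod : (1 + x) ^ k * (1 - x) ^ k ≤ 1 := by
    rw [← mul_pow]
    exact pow_le_one₀ (by nlinarith) (by nlinarith)
  have hpos : 0 ≤ (1 + x) ^ k := by positivity
  have hup : (1 + x) ^ k ≤ 1 + β := by
    nlinarith [mul_le_mul_of_nonneg_left hbern hpos]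
  calc (1 + x) ^ k * (1 - β) ≤ (1 + β) * (1 - β) := by gcongr
    _ ≤ (1 + β) * (1 - x) ^ k := by gcongr; linarith

lemma mul_half_sqrt_le {d k : ℕ} (hkd : k ≤ d) {β r : ℝ} (hβ : 0 < β)
    (hr : 2 * (d : ℝ) ^ ((3 : ℝ) / 2) / β < r) : k * (√k / 2) ≤ β / 4 * r := by
  have hpow : (d : ℝ) ^ ((3 : ℝ) / 2) = d * √d := by
    rw [show (3 : ℝ) / 2 = 1 + 1 / 2 by norm_num,
      Real.rpow_add_of_nonneg (Nat.cast_nonneg d) (by norm_num) (by norm_num), Real.rpow_one,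
      Real.sqrt_eq_rpow]
  rw [hpow, div_lt_iff₀ hβ] at hr
  have : (k : ℝ) * √k ≤ d * √d := by gcongr
  linarith


theorem lattice_count_close_radii (d k : ℕ) (hk : 1 ≤ k) (hkd : k ≤ d)
    (β δ : ℝ) (hβ0 : 0 < β) (hβ1 : β < 1) (hδ : 0 ≤ δ)
    (q : Fin k → ℤ) (r' r'' : ℝ)
    (hr'' : 2 * (d : ℝ) ^ ((3 : ℝ) / 2) / β < r'')
    (h1 : r'' ≤ r') (h2 : r' ≤ (1 + δ) * r'') :
    Set.ncard {z : Fin k → ℤ | ∑ i : Fin k, ((z i : ℝ) - (q i : ℝ)) ^ 2 ≤ r'' ^ 2}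
        ≤ Set.ncard {z : Fin k → ℤ | ∑ i : Fin k, ((z i : ℝ) - (q i : ℝ)) ^ 2 ≤ r' ^ 2} ∧
      (Set.ncard {z : Fin k → ℤ | ∑ i : Fin k, ((z i : ℝ) - (q i : ℝ)) ^ 2 ≤ r' ^ 2} : ℝ)
        ≤ (1 + β) / (1 - β) * (1 + δ) ^ k *
          (Set.ncard {z : Fin k → ℤ | ∑ i : Fin k, ((z i : ℝ) - (q i : ℝ)) ^ 2 ≤ r'' ^ 2} : ℝ) := by

  have hs : 0 ≤ √(k : ℝ) / 2 := by positivity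
  have hk' : (1 : ℝ) ≤ k := by exact_mod_cast hk
  have hr0 : 0 < r'' := lt_of_le_of_lt (by positivity) hr''
  have hks := mul_half_sqrt_le hkd hβ0 hr''
  have hsr : √(k : ℝ) / 2 < r'' := by nlinarith
  simp only [ncard_translate_latticeBall]
  refine ⟨Set.ncard_le_ncard (fun z hz => ?_) (finite_latticeBall k r'), ?_⟩
  · simp only [latticeBall, Set.mem_ofPred_eq] at hz ⊢
    exact hz.trans (by gcongr)
  have hcount := ncard_latticeBall_mul_pow_le k hsr (hr0.trans_le h1)
  set s := √(k : ℝ) / 2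
  set N := ((latticeBall k r'').ncard : ℝ)
  have hratio : (r'' + s) ^ k * (1 - β) ≤ (1 + β) * (r'' - s) ^ k := by
    have h := one_add_pow_mul_le (k := k) (x := s / r'') (by positivity)
      ((div_lt_one hr0).2 hsr) hβ0 hβ1 (by rwa [← mul_div_assoc, div_le_iff₀ hr0])
    have hp : r'' + s = r'' * (1 + s / r'') := by field_simp
    have hm : r'' - s = r'' * (1 - s / r'') := by field_simp
    rw [hp, hm, mul_pow, mul_pow]
    calc _ = r'' ^ k * ((1 + s / r'') ^ k * (1 - β)) := by ring
      _ ≤ r'' ^ k * ((1 + β) * (1 - s / r'') ^ k) := by gcongr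
      _ = _ := by ring
  have hpos : 0 < (r'' - s) ^ k := pow_pos (sub_pos.2 hsr) k
  have hβ : 0 < 1 - β := sub_pos.2 hβ1
  refine le_of_mul_le_mul_right (hcount.trans ?_) hpos
  calc (r' + s) ^ k * N ≤ ((1 + δ) * (r'' + s)) ^ k * N := by
        gcongr
        · linarith
        · nlinarith
    _ = (1 + δ) ^ k * N * (r'' + s) ^ k := by rw [mul_pow]; ring
    _ ≤ (1 + δ) ^ k * N * ((1 + β) * (r'' - s) ^ k / (1 - β)) := by
        gcongr
        rwa [le_div_iff₀ hβ]
    _ = _ := by ring
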